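/- For all positive integers m and k: (m+1)^{k+2}/((k+1)(k+2)) − 4(m+1)^{k+1}/(k+1) ≤ Σ_{τ=1}^{m} (m−τ)τ^k ≤ m^{k+2}/((k+1)(k+2)) + 2m^{k+1}/(k+1). -/

import Mathlib

/-- The forward difference of `x ^ (p + 1)` is at least the derivative at `x`. -/
lemma pow_succ_add_le_add_one_pow (p : ℕ) {x : ℝ} (hx : 0 ≤ x) :
    x ^ (p + 1) + ((p : ℝ) + 1) * x ^ p ≤ (x + 1) ^ (p + 1) := by
  induction p with
  | zero => simp
  | succ p ih =>
    have h := mul_le_mul_of_nonneg_left ih (by positivity : 0 ≤ x + 1)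
    have h0 : 0 ≤ ((p : ℝ) + 1) * x ^ p := by positivity
    push_cast
    simp only [pow_succ] at *
    linarith

/-- The forward difference of `x ^ (p + 1)` is at most the derivative at `x + 1`. -/
lemma add_one_pow_le_pow_succ_add (p : ℕ) {x : ℝ} (hx : 0 ≤ x) :
    (x + 1) ^ (p + 1) ≤ x ^ (p + 1) + ((p : ℝ) + 1) * (x + 1) ^ p := by
  induction p with
  | zero => simp
  | succ p ih =>
    have h := mul_le_mul_of_nonneg_left ih hx
    have h0 : 0 ≤ ((p : ℝ) + 1) * (x + 1) ^ p := by positivity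
    push_cast
    simp only [pow_succ] at *
    linarith

lemma mul_sum_Icc_pow_le (p n : ℕ) :
    ((p : ℝ) + 1) * ∑ τ ∈ Finset.Icc 1 n, (τ : ℝ) ^ p ≤
      (n : ℝ) ^ (p + 1) + ((p : ℝ) + 1) * (n : ℝ) ^ p := by
  induction n with
  | zero =>
    simp only [zero_lt_one, Finset.Icc_eq_empty_of_lt, Finset.sum_empty, mul_zero]
    positivity
  | succ n ih =>
    rw [Finset.sum_Icc_succ_top (by omega)]
    have h := pow_succ_add_le_add_one_pow p (Nat.cast_nonneg (α := ℝ) n)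
    push_cast
    linarith

lemma pow_succ_le_mul_sum_Icc_pow (p n : ℕ) :
    (n : ℝ) ^ (p + 1) ≤ ((p : ℝ) + 1) * ∑ τ ∈ Finset.Icc 1 n, (τ : ℝ) ^ p := by
  induction n with
  | zero => simp
  | succ n ih =>
    rw [Finset.sum_Icc_succ_top (by omega)]
    have h := add_one_pow_le_pow_succ_add p (Nat.cast_nonneg (α := ℝ) n)
    push_cast
    linarith

lemma sum_Icc_sub_mul_pow_succ (k m : ℕ) :
    ∑ τ ∈ Finset.Icc 1 (m + 1), (((m + 1 : ℕ) : ℝ) - (τ : ℝ)) * (τ : ℝ) ^ k =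
      ∑ τ ∈ Finset.Icc 1 m, ((m : ℝ) - (τ : ℝ)) * (τ : ℝ) ^ k +
        ∑ τ ∈ Finset.Icc 1 m, (τ : ℝ) ^ k := by
  rw [Finset.sum_Icc_succ_top (by omega), sub_self, zero_mul, add_zero,
    ← Finset.sum_add_distrib]
  refine Finset.sum_congr rfl fun τ _ => ?_
  push_cast
  ring

lemma mul_sum_Icc_sub_mul_pow_le (k m : ℕ) :
    ((k : ℝ) + 1) * ((k : ℝ) + 2) * ∑ τ ∈ Finset.Icc 1 m, ((m : ℝ) - (τ : ℝ)) * (τ : ℝ) ^ k ≤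
      (m : ℝ) ^ (k + 2) + ((k : ℝ) + 2) * (m : ℝ) ^ (k + 1) := by
  induction m with
  | zero => simp
  | succ m ih =>
    rw [sum_Icc_sub_mul_pow_succ]
    have hm : (0 : ℝ) ≤ m := Nat.cast_nonneg m
    have hk : (0 : ℝ) ≤ (k : ℝ) + 2 := by positivity
    have h1 := mul_le_mul_of_nonneg_left (mul_sum_Icc_pow_le k m) hk
    have h2 := pow_succ_add_le_add_one_pow (k + 1) hm
    have h3 := mul_le_mul_of_nonneg_left (pow_succ_add_le_add_one_pow k hm) hk
    push_cast at h2 ⊢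
    linarith

lemma le_mul_sum_Icc_sub_mul_pow (k m : ℕ) :
    ((m : ℝ) + 1) ^ (k + 2) - 2 * ((k : ℝ) + 2) * ((m : ℝ) + 1) ^ (k + 1) ≤
      ((k : ℝ) + 1) * ((k : ℝ) + 2) *
        ∑ τ ∈ Finset.Icc 1 m, ((m : ℝ) - (τ : ℝ)) * (τ : ℝ) ^ k := by
  induction m with
  | zero =>
    have : (0 : ℝ) ≤ k := Nat.cast_nonneg k
    simp
    linarith
  | succ m ih =>
    rw [sum_Icc_sub_mul_pow_succ]
    have hm : (0 : ℝ) ≤ m := Nat.cast_nonneg m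
    have hm1 : (0 : ℝ) ≤ (m : ℝ) + 1 := by positivity
    have hk : (0 : ℝ) ≤ (k : ℝ) + 2 := by positivity
    have h1 := mul_le_mul_of_nonneg_left (pow_succ_le_mul_sum_Icc_pow k m) hk
    have h2 := add_one_pow_le_pow_succ_add (k + 1) hm1
    have h3 := mul_le_mul_of_nonneg_left (pow_succ_add_le_add_one_pow k hm1) hk
    have h4 := mul_le_mul_of_nonneg_left (add_one_pow_le_pow_succ_add k hm) hk
    push_cast at h2 ⊢
    linarith


/-- for positive integers `m` and `k`,
`(m+1)^{k+2}/((k+1)(k+2)) − 4(m+1)^{k+1}/(k+1) ≤ Σ_{τ=1}^m (m−τ)τ^k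
  ≤ m^{k+2}/((k+1)(k+2)) + 2 m^{k+1}/(k+1)`. -/
theorem stmt14 (m k : ℕ) (hm : 0 < m) (hk : 0 < k) :
    ((m : ℝ) + 1) ^ (k + 2) / (((k : ℝ) + 1) * ((k : ℝ) + 2)) -
        4 * ((m : ℝ) + 1) ^ (k + 1) / ((k : ℝ) + 1) ≤
      ∑ τ ∈ Finset.Icc 1 m, ((m : ℝ) - (τ : ℝ)) * (τ : ℝ) ^ k ∧
    ∑ τ ∈ Finset.Icc 1 m, ((m : ℝ) - (τ : ℝ)) * (τ : ℝ) ^ k ≤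
      (m : ℝ) ^ (k + 2) / (((k : ℝ) + 1) * ((k : ℝ) + 2)) +
        2 * (m : ℝ) ^ (k + 1) / ((k : ℝ) + 1) := by
  have hk1 : (0 : ℝ) < (k : ℝ) + 1 := by positivity
  have hk2 : (0 : ℝ) < (k : ℝ) + 2 := by positivity
  have hkk := mul_pos hk1 hk2
  have hl := le_mul_sum_Icc_sub_mul_pow k m
  have hu := mul_sum_Icc_sub_mul_pow_le k m
  have hp : 0 ≤ ((k : ℝ) + 2) * ((m : ℝ) + 1) ^ (k + 1) := by positivity
  have hq : 0 ≤ ((k : ℝ) + 2) * (m : ℝ) ^ (k + 1) := by positivity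
  rw [← mul_div_mul_right (4 * ((m : ℝ) + 1) ^ (k + 1)) _ hk2.ne',
    ← mul_div_mul_right (2 * (m : ℝ) ^ (k + 1)) _ hk2.ne', ← sub_div, ← add_div,
    div_le_iff₀ hkk, le_div_iff₀ hkk]
  constructor <;> linarith
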